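/- Let k, d, q be positive integers with k ≥ 2, q ≥ 2, and d ≥ k·(4q)^{4k·log(k)} (logarithm base 2). Let A ⊆ L(T_{k,d}) be a q-subset. Suppose a scheme β = (f_v)_{v ∈ V(T_{k,d})} for T_{k,d} is chosen by picking each bijection f_v : L(T^v) → {1,...,Leaves(v)} independently and uniformly at random. Then the probability that no vertex of T_{k,d} forms a collision with respect to (A, β) is at most exp(−k^d). -/

import Mathlib

open MeasureTheory

/-- The uniform probability measure on a finite type (with the `⊤` σ-algebra). -/
noncomputable def uniformMeasure (α : Type*) [Fintype α] : @Measure α ⊤ :=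
  (Fintype.card α : ENNReal)⁻¹ • @Measure.count α ⊤

/-- A vertex of the full `k`-ary tree `T_{k,d}`: a depth `h ∈ {0, …, d}` together with the
word of length `h` describing the path from the root. Leaves of `T_{k,d}` are modelled as
words `Fin d → Fin k`. -/
abbrev Vtx (k d : ℕ) := Σ h : Fin (d + 1), (Fin (h : ℕ) → Fin k)

/-- The leaf set `L(T^v)` of the subtree rooted at `v`: all words extending the prefix `v.2`.
It has `Leaves(v) = k ^ (d - depth v)` elements. -/
def subLeaves {k d : ℕ} (v : Vtx k d) : Finset (Fin d → Fin k) :=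
  Finset.univ.filter fun w => ∀ i : Fin (v.1 : ℕ), w (Fin.castLE v.1.is_le i) = v.2 i

/-- A scheme for `T_{k,d}`: a bijection `f_v : L(T^v) ≃ {1, …, Leaves(v)}` for every vertex
`v` of `T_{k,d}`. -/
abbrev Scheme (k d : ℕ) :=
  ∀ v : Vtx k d, {w // w ∈ subLeaves v} ≃ Fin (k ^ (d - (v.1 : ℕ)))

/-- The `c`-th child of a non-leaf vertex `v` of `T_{k,d}`. -/
abbrev child {k d : ℕ} (v : Vtx k d) (hv : (v.1 : ℕ) < d) (c : Fin k) : Vtx k d :=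
  ⟨⟨(v.1 : ℕ) + 1, by omega⟩, Fin.snoc v.2 c⟩

/-- The vertex `u` forms a collision with respect to `(A, β)` if `A` contains leaves
`a_1, …, a_k`, one in the subtree of each of the `k` (distinct) children `u_1, …, u_k` of `u`,
with `f_{u_1}(a_1) = ⋯ = f_{u_k}(a_k)`. -/
def Collision {k d : ℕ} (A : Finset (Fin d → Fin k)) (β : Scheme k d) (u : Vtx k d) : Prop :=
  ∃ (hu : (u.1 : ℕ) < d) (x : Fin (k ^ (d - ((u.1 : ℕ) + 1)))),
    ∀ c : Fin k, ∃ a, ∃ ha : a ∈ subLeaves (child u hu c), a ∈ A ∧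
      β (child u hu c) ⟨a, ha⟩ = x

open Finset in
lemma sum_equiv_pow_card_filter_le {X Y : Type*} [Fintype X] [Fintype Y] [DecidableEq X]
    [DecidableEq Y] (S : Finset X) (B : Finset Y) {t : ℝ} (ht0 : 0 ≤ t) (ht1 : t ≤ 1) :
    ∑ g : X ≃ Y, (1 - t) ^ #{y ∈ B | g.symm y ∈ S} ≤
      (1 - t * (#S / Fintype.card Y)) ^ #B * Fintype.card (X ≃ Y) := by
  classical
  rcases isEmpty_or_nonempty (X ≃ Y) with hE | ⟨⟨g₀⟩⟩
  · simp
  have hcard : Fintype.card X = Fintype.card Y := Fintype.card_congr g₀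
  have hSN : (#S : ℝ) ≤ Fintype.card Y := by
    rw [← hcard]; exact_mod_cast S.card_le_univ
  set N : ℝ := (Fintype.card Y : ℝ) with hN
  set M : ℝ := (Fintype.card (X ≃ Y) : ℝ) with hM
  have hcount (g : X ≃ Y) : ∑ y : Y, (if g.symm y ∈ S then (1 : ℝ) else 0) = #S := by
    rw [Equiv.sum_comp g.symm (fun x => if x ∈ S then (1 : ℝ) else 0)]
    simp
  -- Relabelling two points of `Y` outside `B` does not change the weighted hitting sum.
  have hswap (C : Finset Y) (y z : Y) (hy : y ∉ C) (hz : z ∉ C) :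
      ∑ g : X ≃ Y, (1 - t) ^ #{w ∈ C | g.symm w ∈ S} * (if g.symm y ∈ S then (1 : ℝ) else 0) =
      ∑ g : X ≃ Y, (1 - t) ^ #{w ∈ C | g.symm w ∈ S} *
        (if g.symm z ∈ S then (1 : ℝ) else 0) := by
    rw [← Equiv.sum_comp (Equiv.equivCongr (Equiv.refl X) (Equiv.swap y z))]
    refine Finset.sum_congr rfl fun g _ => ?_
    congr 2
    · congr 1
      refine Finset.filter_congr fun w hw => ?_
      have h1 : w ≠ y := fun h => hy (h ▸ hw)
      have h2 : w ≠ z := fun h => hz (h ▸ hw)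
      simp [Equiv.swap_apply_of_ne_of_ne h1 h2]
    · simp
  have hmean (y : Y) : N * ∑ g : X ≃ Y, (if g.symm y ∈ S then (1 : ℝ) else 0) = #S * M := by
    have h1 : ∑ z : Y, ∑ g : X ≃ Y, (if g.symm z ∈ S then (1 : ℝ) else 0) = #S * M := by
      rw [Finset.sum_comm, Finset.sum_congr rfl fun g _ => hcount g]
      simp [hM, mul_comm]
    rw [← h1, Finset.sum_congr rfl fun z _ => (by simpa using hswap ∅ z y (by simp) (by simp) :
        ∑ g : X ≃ Y, (if g.symm z ∈ S then (1 : ℝ) else 0) =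
          ∑ g : X ≃ Y, (if g.symm y ∈ S then (1 : ℝ) else 0)), Finset.sum_const, nsmul_eq_mul,
      Finset.card_univ]
  induction B using Finset.induction_on with
  | empty => simp [hM]
  | insert x B hx ih =>
    have hNpos : 0 < N := by
      rw [hN]; exact_mod_cast Fintype.card_pos_iff.2 ⟨x⟩
    have hBN : (#B : ℝ) < N := by
      rw [hN]; exact_mod_cast Finset.card_lt_univ_of_notMem hx
    have hMpos : 0 < M := by
      rw [hM]; exact_mod_cast Fintype.card_pos_iff.2 ⟨g₀⟩
    set F : (X ≃ Y) → ℝ := fun g => (1 - t) ^ #{y ∈ B | g.symm y ∈ S} with hF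
    set I : Y → (X ≃ Y) → ℝ := fun y g => if g.symm y ∈ S then 1 else 0 with hI
    have hstep : ∑ g : X ≃ Y, (1 - t) ^ #{y ∈ insert x B | g.symm y ∈ S} =
        ∑ g, F g - t * ∑ g, F g * I x g := by
      rw [Finset.mul_sum, ← Finset.sum_sub_distrib]
      refine Finset.sum_congr rfl fun g _ => ?_
      by_cases h : g.symm x ∈ S
      · rw [Finset.filter_insert, if_pos h, Finset.card_insert_of_notMem (by simp [hx])]
        simp only [hF, hI, if_pos h]; ring
      · rw [Finset.filter_insert, if_neg h]
        simp only [hF, hI, if_neg h]; ring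
    have hY (g : X ≃ Y) : ∑ y ∈ B, I y g = #{y ∈ B | g.symm y ∈ S} := by
      simp [hI]
    have hout (g : X ≃ Y) : ∑ y ∈ Bᶜ, I y g = #S - #{y ∈ B | g.symm y ∈ S} := by
      rw [← hY, ← hcount g, ← Finset.sum_compl_add_sum B]
      simp [hI]
    have hsymm : (N - #B) * ∑ g, F g * I x g =
        ∑ g, F g * (#S - #{y ∈ B | g.symm y ∈ S} : ℝ) := by
      have h1 : ∑ g, F g * (#S - #{y ∈ B | g.symm y ∈ S} : ℝ) =
          ∑ y ∈ Bᶜ, ∑ g, F g * I y g := by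
        rw [Finset.sum_comm]
        exact Finset.sum_congr rfl fun g _ => by rw [← hout, Finset.mul_sum]
      rw [h1, Finset.sum_congr rfl fun y hy => hswap B y x (by simpa using hy) hx,
        Finset.sum_const, nsmul_eq_mul, Finset.card_compl, Nat.cast_sub (Finset.card_le_univ _)]
    have hsum : N * ∑ g : X ≃ Y, (#S - #{y ∈ B | g.symm y ∈ S} : ℝ) = (N - #B) * (#S * M) := by
      have h1 : ∑ g : X ≃ Y, (#S - #{y ∈ B | g.symm y ∈ S} : ℝ) = ∑ y ∈ Bᶜ, ∑ g, I y g := by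
        rw [Finset.sum_comm]
        exact Finset.sum_congr rfl fun g _ => (hout g).symm
      rw [h1, Finset.mul_sum, Finset.sum_congr rfl fun y _ => hmean y,
        Finset.sum_const, nsmul_eq_mul, Finset.card_compl, Nat.cast_sub (Finset.card_le_univ _)]
    have hcheb : (∑ g, F g) * ∑ g : X ≃ Y, (#S - #{y ∈ B | g.symm y ∈ S} : ℝ) ≤
        M * ∑ g, F g * (#S - #{y ∈ B | g.symm y ∈ S} : ℝ) := by
      have hmono : Monovary F fun g : X ≃ Y => (#S - #{y ∈ B | g.symm y ∈ S} : ℝ) := by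
        intro g g' h
        have h' : #{y ∈ B | g'.symm y ∈ S} ≤ #{y ∈ B | g.symm y ∈ S} := by
          have : (#{y ∈ B | g'.symm y ∈ S} : ℝ) < #{y ∈ B | g.symm y ∈ S} := by linarith
          exact_mod_cast this.le
        exact pow_le_pow_of_le_one (by linarith) (by linarith) h'
      exact hmono.sum_mul_sum_le_card_mul_sum
    have hkey : #S / N * ∑ g, F g ≤ ∑ g, F g * I x g := by
      rw [← hsymm] at hcheb
      have h2 : (N - #B) * M * (#S * ∑ g, F g) ≤ (N - #B) * M * (N * ∑ g, F g * I x g) := by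
        calc _ = (∑ g, F g) * ((N - #B) * (#S * M)) := by ring
          _ = N * ((∑ g, F g) * ∑ g : X ≃ Y, (#S - #{y ∈ B | g.symm y ∈ S} : ℝ)) := by
            rw [← hsum]; ring
          _ ≤ N * (M * ((N - #B) * ∑ g, F g * I x g)) := by gcongr
          _ = _ := by ring
      have h3 := le_of_mul_le_mul_left h2 (mul_pos (by linarith) hMpos)
      rw [div_mul_eq_mul_div, div_le_iff₀ hNpos]
      linarith
    have hfac : 0 ≤ 1 - t * (#S / N) := by
      have : #S / N ≤ 1 := (div_le_one hNpos).2 hSN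
      nlinarith [show 0 ≤ #S / N by positivity]
    rw [hstep, Finset.card_insert_of_notMem hx, pow_succ]
    calc _ ≤ (1 - t * (#S / N)) * ∑ g, F g := by nlinarith
      _ ≤ (1 - t * (#S / N)) * ((1 - t * (#S / N)) ^ #B * M) := by gcongr
      _ = _ := by ring

open Finset in
lemma sum_pi_equiv_pow_card_filter_le {Y : Type*} [Fintype Y] [DecidableEq Y] :
    ∀ {n : ℕ} {X : Fin n → Type*} [∀ c, Fintype (X c)] [∀ c, DecidableEq (X c)]
    (S : ∀ c, Finset (X c)) (B : Finset Y) {t : ℝ} (_ : 0 ≤ t) (_ : t ≤ 1)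
    (_ : ∀ c, #(S c) ≤ Fintype.card Y),
    ∑ g : ∀ c, X c ≃ Y, (1 - t) ^ #{y ∈ B | ∀ c, (g c).symm y ∈ S c} ≤
      (1 - t * ∏ c, (#(S c) / Fintype.card Y : ℝ)) ^ #B * Fintype.card (∀ c, X c ≃ Y) := by
  classical
  intro n
  induction n with
  | zero => intro X _ _ S B t _ _ _; simp
  | succ n ih =>
    intro X _ _ S B t ht0 ht1 hS
    have hfrac : (#(S 0) / Fintype.card Y : ℝ) ≤ 1 :=
      div_le_one_of_le₀ (by exact_mod_cast hS 0) (by positivity)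
    have hfrac0 : (0 : ℝ) ≤ #(S 0) / Fintype.card Y := by positivity
    rw [← Equiv.sum_comp (Fin.consEquiv fun c => X c ≃ Y), Fintype.sum_prod_type_right]
    have hinner (g' : ∀ c : Fin n, X c.succ ≃ Y) :
        ∑ g : X 0 ≃ Y, (1 - t) ^
          #{y ∈ B | ∀ c, ((Fin.consEquiv fun c => X c ≃ Y) (g, g') c).symm y ∈ S c} ≤
        (1 - t * (#(S 0) / Fintype.card Y)) ^ #{y ∈ B | ∀ c, (g' c).symm y ∈ S c.succ} *
          Fintype.card (X 0 ≃ Y) := by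
      refine le_trans (le_of_eq ?_) (sum_equiv_pow_card_filter_le (S 0) _ ht0 ht1)
      refine Finset.sum_congr rfl fun g _ => ?_
      congr 2
      rw [Finset.filter_filter]
      refine Finset.filter_congr fun y _ => ?_
      rw [Fin.forall_fin_succ]
      simp [Fin.consEquiv, and_comm]
    refine (Finset.sum_le_sum fun g' _ => hinner g').trans ?_
    rw [← Finset.sum_mul]
    have := ih (fun c => S c.succ) B (mul_nonneg ht0 hfrac0)
      (mul_le_one₀ ht1 hfrac0 hfrac) fun c => hS c.succ
    refine (mul_le_mul_of_nonneg_right this (by positivity)).trans (le_of_eq ?_)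
    rw [Fin.prod_univ_succ, ← Fintype.card_congr (Fin.consEquiv fun c => X c ≃ Y),
      Fintype.card_prod]
    push_cast
    ring

lemma card_filter_restrict_mul_card {ι κ : Type*} [Fintype ι] [DecidableEq ι] [Fintype κ]
    [DecidableEq κ] {X : ι → Type*} [∀ i, Fintype (X i)] {j : κ → ι} (hj : j.Injective)
    (P : (∀ w, X (j w)) → Prop) [DecidablePred P] :
    (Finset.univ.filter fun β : ∀ i, X i => P fun w => β (j w)).card *
        Fintype.card (∀ w, X (j w)) =
      (Finset.univ.filter P).card * Fintype.card (∀ i, X i) := by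
  classical
  let r : (∀ i, X i) → (∀ w, X (j w)) × (∀ i : {i // i ∉ Set.range j}, X i) :=
    fun β => (fun w => β (j w), fun i => β i)
  have hr : r.Bijective := by
    constructor
    · intro β β' h
      funext i
      by_cases hi : i ∈ Set.range j
      · obtain ⟨w, rfl⟩ := hi
        exact congrFun (congrArg Prod.fst h) w
      · exact congrFun (congrArg Prod.snd h) ⟨i, hi⟩
    · rintro ⟨γ, δ⟩
      refine ⟨fun i => if hi : i ∈ Set.range j then hi.choose_spec ▸ γ hi.choose else δ ⟨i, hi⟩, ?_⟩
      refine Prod.ext (funext fun w => ?_) (funext fun i => ?_)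
      · have hw : j w ∈ Set.range j := ⟨w, rfl⟩
        simp only [r, dif_pos hw]
        have key : ∀ w' (e : j w' = j w), (e ▸ γ w' : X (j w)) = γ w := by
          intro w' e
          obtain rfl := hj e
          rfl
        exact key _ _
      · simp only [r, dif_neg i.2]
  have hcard : Fintype.card (∀ i, X i) = Fintype.card (∀ w, X (j w)) *
      Fintype.card (∀ i : {i // i ∉ Set.range j}, X i) := by
    rw [Fintype.card_congr (Equiv.ofBijective r hr), Fintype.card_prod]
  have hfilter : (Finset.univ.filter fun β : ∀ i, X i => P fun w => β (j w)).card =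
      (Finset.univ.filter P).card * Fintype.card (∀ i : {i // i ∉ Set.range j}, X i) := by
    rw [← Finset.card_univ, ← Finset.card_product]
    refine Finset.card_bijective r hr fun β => ?_
    simp [r]
  rw [hfilter, hcard]
  ring

/-- A defect of the product of the `f c` is paid for by their variance. -/
lemma half_mean_pow_le {k : ℕ} (hk : 2 ≤ k) (f : Fin k → ℝ) (hf : ∀ c, 0 ≤ f c) {m : ℝ}
    (hm : ∑ c, f c = k * m) (hm1 : m ≤ 1) :
    (m / 2) ^ k ≤ ∏ c, f c + (∑ c, f c ^ 2 - k * m ^ 2) := by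
  have hk0 : (0 : ℝ) < k := by positivity
  have hm0 : 0 ≤ m := by
    have : 0 ≤ (k : ℝ) * m := hm ▸ Finset.sum_nonneg fun c _ => hf c
    exact nonneg_of_mul_nonneg_right this hk0
  have hvar : ∑ c, (f c - m) ^ 2 = ∑ c, f c ^ 2 - k * m ^ 2 := by
    simp only [sub_sq, Finset.sum_add_distrib, Finset.sum_sub_distrib, ← Finset.sum_mul,
      ← Finset.mul_sum, hm]
    simp
    ring
  rw [← hvar]
  by_cases h : ∀ c, m / 2 ≤ f c
  · have h1 : (m / 2) ^ k ≤ ∏ c, f c := by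
      calc (m / 2) ^ k = ∏ _c : Fin k, m / 2 := by rw [Finset.prod_const, Finset.card_fin]
        _ ≤ _ := Finset.prod_le_prod (fun _ _ => by positivity) fun c _ => h c
    have h2 : 0 ≤ ∑ c, (f c - m) ^ 2 := Finset.sum_nonneg fun _ _ => sq_nonneg _
    linarith
  · push Not at h
    obtain ⟨c, hc⟩ := h
    have h1 : (m / 2) ^ k ≤ (m / 2) ^ 2 :=
      pow_le_pow_of_le_one (by positivity) (by linarith) hk
    have h2 : (f c - m) ^ 2 ≤ ∑ c, (f c - m) ^ 2 :=
      Finset.single_le_sum (f := fun c => (f c - m) ^ 2) (fun _ _ => sq_nonneg _)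
        (Finset.mem_univ c)
    have h3 : 0 ≤ ∏ c, f c := Finset.prod_nonneg fun c _ => hf c
    nlinarith [hf c]

/-- The non-leaf vertices of the full `k`-ary tree of depth `d`. -/
abbrev InnerVtx (k d : ℕ) := Σ h : Fin d, (Fin (h : ℕ) → Fin k)

/-- A non-leaf vertex, seen as a vertex. -/
abbrev InnerVtx.toVtx {k d : ℕ} (u : InnerVtx k d) : Vtx k d := ⟨⟨u.1, by omega⟩, u.2⟩

/-- The `c`-th child of a non-leaf vertex. -/
abbrev InnerVtx.child {k d : ℕ} (u : InnerVtx k d) (c : Fin k) : Vtx k d :=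
  _root_.child u.toVtx u.1.2 c

lemma InnerVtx.child_injective {k d : ℕ} :
    Function.Injective fun w : InnerVtx k d × Fin k => w.1.child w.2 := by
  rintro ⟨⟨⟨h, hh⟩, p⟩, c⟩ ⟨⟨⟨h', hh'⟩, p'⟩, c'⟩ e
  simp only [InnerVtx.child, _root_.child, Sigma.mk.injEq, Fin.mk.injEq,
    Nat.add_right_cancel_iff] at e
  obtain ⟨rfl, e⟩ := e
  obtain ⟨rfl, rfl⟩ := Fin.snoc_injective2 (eq_of_heq e)
  rfl

/-- The fraction of the leaves below `v` that lie in `A`. -/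
noncomputable def leafFrac {k d : ℕ} (A : Finset (Fin d → Fin k)) (v : Vtx k d) : ℝ :=
  (A ∩ subLeaves v).card / (k : ℝ) ^ (d - (v.1 : ℕ))

lemma leafFrac_nonneg {k d : ℕ} (A : Finset (Fin d → Fin k)) (v : Vtx k d) :
    0 ≤ leafFrac A v := by
  unfold leafFrac; positivity

lemma subLeaves_child {k d : ℕ} (u : Vtx k d) (hu : (u.1 : ℕ) < d) (c : Fin k) :
    subLeaves (child u hu c) = (subLeaves u).filter fun w => w ⟨u.1, hu⟩ = c := by
  ext w
  simp only [subLeaves, child, Finset.mem_filter, Finset.mem_univ, true_and]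
  rw [Fin.forall_fin_succ']
  simp only [Fin.snoc_castSucc, Fin.snoc_last]
  rfl

lemma sum_leafFrac_child {k d : ℕ} (hk : 0 < k) (A : Finset (Fin d → Fin k)) (u : Vtx k d)
    (hu : (u.1 : ℕ) < d) : ∑ c, leafFrac A (child u hu c) = k * leafFrac A u := by
  have h1 : (A ∩ subLeaves u).card = ∑ c, (A ∩ subLeaves (child u hu c)).card := by
    rw [Finset.card_eq_sum_card_fiberwise (f := fun w => w ⟨u.1, hu⟩) (t := Finset.univ)
      (fun _ _ => Finset.mem_coe.2 (Finset.mem_univ _))]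
    refine Finset.sum_congr rfl fun c _ => ?_
    rw [subLeaves_child, Finset.inter_filter]
  have h2 : d - (u.1 : ℕ) = (d - ((u.1 : ℕ) + 1)) + 1 := by omega
  simp only [leafFrac, ← Finset.sum_div]
  rw [h1, h2, pow_succ]
  push_cast
  field_simp

lemma sum_leafFrac_level {k d : ℕ} (A : Finset (Fin d → Fin k)) {h : ℕ}
    (hh : h < d + 1) :
    ∑ p : Fin h → Fin k, leafFrac A ⟨⟨h, hh⟩, p⟩ = A.card / (k : ℝ) ^ (d - h) := by
  have h1 : A.card = ∑ p : Fin h → Fin k, (A ∩ subLeaves ⟨⟨h, hh⟩, p⟩).card := by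
    rw [Finset.card_eq_sum_card_fiberwise
      (f := fun w (i : Fin h) => w (Fin.castLE (Nat.lt_succ_iff.1 hh) i)) (t := Finset.univ)
      (fun _ _ => Finset.mem_coe.2 (Finset.mem_univ _))]
    refine Finset.sum_congr rfl fun p _ => ?_
    congr 1
    ext w
    simp [subLeaves, funext_iff]
  simp only [leafFrac, ← Finset.sum_div]
  rw [h1]
  push_cast
  rfl

lemma le_sum_prod_leafFrac {k d q : ℕ} (hk : 2 ≤ k) (hq : 0 < q)
    (hd : 2 * (k : ℝ) * (2 * q) ^ k ≤ d)
    (A : Finset (Fin d → Fin k)) (hA : (k ^ d : ℝ) / q ≤ (A.card : ℝ))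
    (h1 : ∀ v, leafFrac A v ≤ 1) :
    (k : ℝ) ^ d ≤
      ∑ u : InnerVtx k d, (k : ℝ) ^ (d - (u.1 + 1)) * ∏ c, leafFrac A (u.child c) := by
  have hk0 : (0 : ℝ) < k := by positivity
  have hq0 : (0 : ℝ) < q := by positivity
  rw [Fintype.sum_sigma]
  set Z : ℕ → ℝ := fun n => if hn : n < d + 1 then
    (k : ℝ) ^ (d - n) * ∑ p : Fin n → Fin k, leafFrac A ⟨⟨n, hn⟩, p⟩ ^ 2 else 0 with hZ
  have hlevel (h : Fin d) : (k : ℝ) ^ (d - 1) * (1 / (2 * q)) ^ k ≤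
      (∑ p : Fin h → Fin k, (k : ℝ) ^ (d - (h + 1 : ℕ)) *
        ∏ c, leafFrac A (InnerVtx.child ⟨h, p⟩ c)) + (Z (h + 1) - Z h) := by
    obtain ⟨h, hh⟩ := h
    have hsnoc : ∑ p : Fin (h + 1) → Fin k, leafFrac A ⟨⟨h + 1, by omega⟩, p⟩ ^ 2 =
        ∑ p : Fin h → Fin k, ∑ c, leafFrac A (InnerVtx.child ⟨⟨h, hh⟩, p⟩ c) ^ 2 := by
      rw [← Equiv.sum_comp (Fin.snocEquiv fun _ => Fin k), Fintype.sum_prod_type_right]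
      rfl
    have hdh : d - h = (d - (h + 1)) + 1 := by omega
    have hZ1 : Z (h + 1) - Z h = (k : ℝ) ^ (d - (h + 1)) * ∑ p : Fin h → Fin k,
        (∑ c, leafFrac A (InnerVtx.child ⟨⟨h, hh⟩, p⟩ c) ^ 2 -
          k * leafFrac A ⟨⟨h, by omega⟩, p⟩ ^ 2) := by
      simp only [hZ]
      rw [dif_pos (by omega : h + 1 < d + 1), dif_pos (by omega : h < d + 1), hsnoc, hdh,
        Finset.sum_sub_distrib, ← Finset.mul_sum]
      ring
    rw [hZ1, ← Finset.mul_sum, ← mul_add, ← Finset.sum_add_distrib]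
    have hpt : ∑ p : Fin h → Fin k, (leafFrac A ⟨⟨h, by omega⟩, p⟩ / 2) ^ k ≤ _ :=
      Finset.sum_le_sum fun p _ => half_mean_pow_le hk
        (fun c => leafFrac A (InnerVtx.child ⟨⟨h, hh⟩, p⟩ c)) (fun c => leafFrac_nonneg _ _)
        (sum_leafFrac_child (by omega) A (InnerVtx.toVtx ⟨⟨h, hh⟩, p⟩) hh) (h1 _)
    refine le_trans ?_ (mul_le_mul_of_nonneg_left hpt (by positivity))
    have hcard : (Fintype.card (Fin h → Fin k) : ℝ) = (k : ℝ) ^ h := by simp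
    have hjensen := Real.pow_arith_mean_le_arith_mean_pow Finset.univ
      (fun _ : Fin h → Fin k => ((k : ℝ) ^ h)⁻¹)
      (fun p => leafFrac A ⟨⟨h, by omega⟩, p⟩ / 2) (fun _ _ => by positivity)
      (by rw [Finset.sum_const, Finset.card_univ, nsmul_eq_mul, hcard]; field_simp)
      (fun p _ => div_nonneg (leafFrac_nonneg _ _) zero_le_two) k
    rw [← Finset.mul_sum, ← Finset.mul_sum, ← Finset.sum_div,
      sum_leafFrac_level] at hjensen
    have hpow : (k : ℝ) ^ d = k ^ h * k ^ (d - h) := by rw [← pow_add]; congr 1; omega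
    have hmean : 1 / (2 * (q : ℝ)) ≤ ((k : ℝ) ^ h)⁻¹ * (A.card / (k : ℝ) ^ (d - h) / 2) := by
      rw [div_le_iff₀ hq0] at hA
      rw [hpow] at hA
      field_simp
      linarith
    have h3 : (1 / (2 * (q : ℝ))) ^ k ≤ _ :=
      (pow_le_pow_left₀ (by positivity) hmean k).trans hjensen
    have h4 : (k : ℝ) ^ (d - 1) = k ^ (d - (h + 1)) * k ^ h := by
      rw [← pow_add]; congr 1; omega
    rw [h4, mul_assoc]
    gcongr
    calc _ ≤ (k : ℝ) ^ h * _ := mul_le_mul_of_nonneg_left h3 (by positivity)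
      _ = _ := by rw [← mul_assoc, mul_inv_cancel₀ (by positivity), one_mul]
  have hsum := Finset.sum_le_sum fun h (_ : h ∈ (Finset.univ : Finset (Fin d))) => hlevel h
  rw [Finset.sum_add_distrib, Fin.sum_univ_eq_sum_range (fun h => Z (h + 1) - Z h),
    Finset.sum_range_sub, Finset.sum_const, Finset.card_univ, Fintype.card_fin,
    nsmul_eq_mul] at hsum
  have hZd : Z d ≤ (k : ℝ) ^ d := by
    simp only [hZ, dif_pos (Nat.lt_succ_self d), Nat.sub_self, pow_zero, one_mul]
    calc _ ≤ ∑ _p : Fin d → Fin k, (1 : ℝ) :=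
          Finset.sum_le_sum fun p _ => pow_le_one₀ (leafFrac_nonneg _ _) (h1 _)
      _ = _ := by simp
  have hZ0 : 0 ≤ Z 0 := by
    simp only [hZ, dif_pos (Nat.succ_pos d)]
    positivity
  have hd0 : d ≠ 0 := by
    rintro rfl
    have : 0 < 2 * (k : ℝ) * (2 * q) ^ k := by positivity
    norm_num at hd
    linarith
  have hmain : 2 * (k : ℝ) ^ d ≤ d * ((k : ℝ) ^ (d - 1) * (1 / (2 * q)) ^ k) := by
    have h5 : (k : ℝ) ^ d = k ^ (d - 1) * k := (pow_sub_one_mul hd0 _).symm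
    rw [h5, one_div, inv_pow]
    calc 2 * ((k : ℝ) ^ (d - 1) * k) =
        (2 * k * (2 * q) ^ k) * (k ^ (d - 1) * ((2 * (q : ℝ)) ^ k)⁻¹) := by field_simp
      _ ≤ _ := by gcongr
  linarith

lemma card_no_collision_le {k d : ℕ} (A : Finset (Fin d → Fin k))
    (hcard : ∀ v : Vtx k d, (subLeaves v).card = k ^ (d - (v.1 : ℕ)))
    [DecidablePred fun β : Scheme k d => ∀ u : Vtx k d, ¬ Collision A β u] :
    ((Finset.univ.filter fun β : Scheme k d => ∀ u : Vtx k d, ¬ Collision A β u).card : ℝ) ≤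
      (∏ u : InnerVtx k d, (1 - ∏ c, leafFrac A (u.child c)) ^ k ^ (d - (u.1 + 1 : ℕ))) *
        Fintype.card (Scheme k d) := by
  classical
  let E : InnerVtx k d × Fin k → Type := fun w =>
    {a // a ∈ subLeaves (w.1.child w.2)} ≃ Fin (k ^ (d - (w.1.1 + 1 : ℕ)))
  let curryE : (∀ w, E w) ≃ ∀ u c, E (u, c) :=
    ⟨fun γ u c => γ (u, c), fun γ w => γ w.1 w.2, fun _ => rfl, fun _ => rfl⟩
  let Q : ∀ u : InnerVtx k d, (∀ c, E (u, c)) → Prop := fun u g =>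
    ∀ x : Fin (k ^ (d - (u.1 + 1 : ℕ))), ¬ ∀ c, ((g c).symm x : Fin d → Fin k) ∈ A
  have hcoll (β : Scheme k d) : (∀ u : Vtx k d, ¬ Collision A β u) ↔
      ∀ u : InnerVtx k d, Q u fun c => β (u.child c) := by
    have key (u : InnerVtx k d) : ¬ Collision A β u.toVtx ↔ Q u fun c => β (u.child c) := by
      simp only [Q, ← not_exists]
      refine not_congr ⟨?_, ?_⟩
      · rintro ⟨_, x, h⟩
        refine ⟨x, fun c => ?_⟩
        obtain ⟨a, ha, haA, hx⟩ := h c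
        rw [← hx]
        erw [Equiv.symm_apply_apply]
        exact haA
      · rintro ⟨x, h⟩
        exact ⟨u.1.2, x, fun c => ⟨_, ((β (u.child c)).symm x).2, h c,
          (β (u.child c)).apply_symm_apply x⟩⟩
    refine ⟨fun h u => (key u).1 (h _), fun h u => ?_⟩
    by_cases hu : (u.1 : ℕ) < d
    · exact (key ⟨⟨u.1, hu⟩, u.2⟩).2 (h _)
    · exact fun ⟨hu', _⟩ => hu hu'
  have hrestrict := card_filter_restrict_mul_card (X := fun v : Vtx k d =>
    {w // w ∈ subLeaves v} ≃ Fin (k ^ (d - (v.1 : ℕ)))) InnerVtx.child_injective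
    (fun γ => ∀ u : InnerVtx k d, Q u fun c => γ (u, c))
  have hcurry : (Finset.univ.filter fun γ : ∀ w, E w => ∀ u : InnerVtx k d,
      Q u fun c => γ (u, c)).card = ∏ u : InnerVtx k d, (Finset.univ.filter (Q u)).card := by
    rw [← Fintype.card_piFinset]
    refine Finset.card_bijective (fun γ u c => γ (u, c)) ?_ fun γ => by simp
    exact curryE.bijective
  have hfactor (u : InnerVtx k d) : ((Finset.univ.filter (Q u)).card : ℝ) ≤
      (1 - ∏ c, leafFrac A (u.child c)) ^ k ^ (d - (u.1 + 1 : ℕ)) *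
        Fintype.card (∀ c, E (u, c)) := by
    have hS (c : Fin k) : (A.subtype (· ∈ subLeaves (u.child c))).card =
        (A ∩ subLeaves (u.child c)).card := by
      rw [Finset.card_subtype, Finset.filter_mem_eq_inter]
    have h := sum_pi_equiv_pow_card_filter_le (Y := Fin (k ^ (d - (u.1 + 1 : ℕ))))
      (fun c => A.subtype (· ∈ subLeaves (u.child c))) Finset.univ zero_le_one le_rfl
      (fun c => by
        rw [hS, Fintype.card_fin, ← hcard (u.child c)]
        exact Finset.card_le_card Finset.inter_subset_right)
    simp only [hS, Fintype.card_fin, Finset.card_univ, one_mul] at h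
    refine le_trans (le_of_eq ?_) (h.trans (le_of_eq ?_))
    · rw [Finset.card_filter]
      push_cast
      refine Finset.sum_congr rfl fun g _ => ?_
      by_cases hg : Q u g
      · rw [if_pos hg, Finset.filter_false_of_mem, Finset.card_empty, pow_zero]
        intro x _ hx
        exact hg x fun c => Finset.mem_subtype.1 (hx c)
      · rw [if_neg hg, sub_self, zero_pow]
        simp only [Q, not_forall] at hg
        obtain ⟨x, hx⟩ := hg
        refine Finset.card_ne_zero_of_mem (a := x) ?_
        simpa using hx
    · simp [leafFrac, E]
  have hpos : (0 : ℝ) < Fintype.card (∀ w, E w) := by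
    have (w : InnerVtx k d × Fin k) : Nonempty (E w) :=
      ⟨Fintype.equivFinOfCardEq (by rw [Fintype.card_coe]; exact hcard _)⟩
    exact_mod_cast Fintype.card_pos
  have hprod : (Fintype.card (∀ w, E w) : ℝ) =
      ∏ u : InnerVtx k d, (Fintype.card (∀ c, E (u, c)) : ℝ) := by
    rw [Fintype.card_congr curryE, Fintype.card_pi]
    push_cast
    rfl
  refine le_of_mul_le_mul_right ?_ hpos
  calc _ = ((∏ u : InnerVtx k d, (Finset.univ.filter (Q u)).card : ℕ) : ℝ) *
        Fintype.card (Scheme k d) := by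
        rw [← hcurry]
        simp only [hcoll]
        exact_mod_cast hrestrict
    _ ≤ (∏ u : InnerVtx k d, (1 - ∏ c, leafFrac A (u.child c)) ^ k ^ (d - (u.1 + 1 : ℕ)) *
        Fintype.card (∀ c, E (u, c))) * Fintype.card (Scheme k d) := by
        push_cast
        gcongr
        exact hfactor _
    _ = _ := by
        rw [Finset.prod_mul_distrib, hprod]
        ring

lemma uniformMeasure_apply_le {α : Type*} [Fintype α] (s : Set α) [DecidablePred (· ∈ s)] {r : ℝ}
    (h : ((Finset.univ.filter (· ∈ s)).card : ℝ) ≤ r * Fintype.card α) :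
    uniformMeasure α s ≤ ENNReal.ofReal r := by
  let _ : MeasurableSpace α := ⊤
  have hcount : Measure.count s = ((Finset.univ.filter (· ∈ s)).card : ENNReal) := by
    rw [← Measure.count_apply_finset]
    congr 1
    ext x
    simp
  have hle : ((Finset.univ.filter (· ∈ s)).card : ENNReal) ≤
      ENNReal.ofReal r * Fintype.card α := by
    rw [← ENNReal.ofReal_natCast, ← ENNReal.ofReal_natCast (Fintype.card α),
      ← ENNReal.ofReal_mul' (by positivity)]
    exact ENNReal.ofReal_le_ofReal h
  change (Fintype.card α : ENNReal)⁻¹ * Measure.count s ≤ _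
  rw [hcount, mul_comm, ← div_eq_mul_inv]
  exact ENNReal.div_le_of_le_mul hle

/-- Let `k, q ≥ 2` and `d ≥ k (4q)^{4 k log₂ k}`, and let `A ⊆ L(T_{k,d})` be a `q`-subset
(`|A| ≥ k^d / q`). If a scheme `β` for `T_{k,d}` is chosen by picking every bijection
independently and uniformly at random, then the probability that no vertex of `T_{k,d}` forms
a collision with respect to `(A, β)` is at most `exp (-k^d)`. -/
theorem prob_no_collision_scheme {k d q : ℕ} (hk : 2 ≤ k) (hq : 2 ≤ q)
    (hd : (k : ℝ) * (4 * (q : ℝ)) ^ (4 * (k : ℝ) * Real.logb 2 k) ≤ (d : ℝ))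
    (A : Finset (Fin d → Fin k)) (hA : (k ^ d : ℝ) / q ≤ (A.card : ℝ)) :
    uniformMeasure (Scheme k d) {β | ∀ u : Vtx k d, ¬ Collision A β u} ≤
      ENNReal.ofReal (Real.exp (-(k : ℝ) ^ d)) := by
  classical
  refine uniformMeasure_apply_le _ ?_
  rcases isEmpty_or_nonempty (Scheme k d) with hE | ⟨⟨β₀⟩⟩
  · simp
  have hcard (v : Vtx k d) : (subLeaves v).card = k ^ (d - (v.1 : ℕ)) := by
    simpa using Fintype.card_congr (β₀ v)
  have hk0 : (0 : ℝ) < k := by positivity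
  have hfrac (v : Vtx k d) : leafFrac A v ≤ 1 := by
    unfold leafFrac
    rw [div_le_one (by positivity)]
    exact_mod_cast (hcard v) ▸ Finset.card_le_card (Finset.inter_subset_right (s₁ := A))
  have hq1 : (1 : ℝ) ≤ q := by exact_mod_cast (by omega : 1 ≤ q)
  have hd' : 2 * (k : ℝ) * (2 * q) ^ k ≤ d := by
    have hlog : 1 ≤ Real.logb 2 k := by
      rw [Real.le_logb_iff_rpow_le one_lt_two hk0, Real.rpow_one]
      exact_mod_cast hk
    refine le_trans ?_ hd
    have h1 : (4 * (q : ℝ)) ^ k ≤ (4 * (q : ℝ)) ^ (4 * (k : ℝ) * Real.logb 2 k) := by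
      rw [← Real.rpow_natCast]
      exact Real.rpow_le_rpow_of_exponent_le (by linarith) (by nlinarith)
    have h2 : 2 * (2 * (q : ℝ)) ^ k ≤ (4 * (q : ℝ)) ^ k := by
      rw [show 4 * (q : ℝ) = 2 * (2 * q) by ring, mul_pow 2 (2 * (q : ℝ))]
      gcongr
      exact le_self_pow₀ one_le_two (by omega)
    nlinarith
  have hsum := le_sum_prod_leafFrac hk (by omega) hd' A hA hfrac
  refine (card_no_collision_le A hcard).trans ?_
  gcongr
  calc _ ≤ ∏ u : InnerVtx k d, Real.exp (-((k : ℝ) ^ (d - (u.1 + 1 : ℕ)) *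
        ∏ c, leafFrac A (u.child c))) := by
        refine Finset.prod_le_prod (fun u _ => ?_) fun u _ => ?_
        · exact pow_nonneg (sub_nonneg.2 (Finset.prod_le_one
            (fun c _ => leafFrac_nonneg _ _) fun c _ => hfrac _)) _
        · rw [neg_mul_eq_mul_neg, ← Nat.cast_pow, Real.exp_nat_mul]
          exact pow_le_pow_left₀ (sub_nonneg.2 (Finset.prod_le_one
            (fun c _ => leafFrac_nonneg _ _) fun c _ => hfrac _)) (Real.one_sub_le_exp_neg _) _
    _ = Real.exp (-∑ u : InnerVtx k d, (k : ℝ) ^ (d - (u.1 + 1 : ℕ)) *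
        ∏ c, leafFrac A (u.child c)) := by
        rw [← Real.exp_sum, Finset.sum_neg_distrib]
    _ ≤ _ := Real.exp_le_exp.2 (neg_le_neg hsum)
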